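/- If the zero set in the positive quadrant of a 4-nomial in two variables has a compact connected component Γ, then the zero set equals Γ; in particular it is connected. -/

import Mathlib

open Set Filter Topology

/-- Through every point of `Z` there is a connected piece of `Z` along which a fixed continuous
function exceeds its value at that point. Such a set has no compact connected component. -/
def Escapes (Z : Set (ℝ × ℝ)) : Prop :=
  ∃ l : ℝ × ℝ → ℝ, Continuous l ∧
    ∀ p ∈ Z, ∃ S ⊆ Z, IsPreconnected S ∧ p ∈ S ∧ ∃ q ∈ S, l p < l q

lemma Escapes.preimage {Z : Set (ℝ × ℝ)} (h : Escapes Z) (e : ℝ × ℝ ≃ₜ ℝ × ℝ) :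
    Escapes (e ⁻¹' Z) := by
  obtain ⟨l, hl, h⟩ := h
  refine ⟨l ∘ e, hl.comp e.continuous, fun p hp => ?_⟩
  obtain ⟨S, hSZ, hS, hpS, q, hqS, hq⟩ := h (e p) hp
  exact ⟨e ⁻¹' S, preimage_mono hSZ, e.isPreconnected_preimage.2 hS, hpS, e.symm q,
    by simpa using hqS, by simpa using hq⟩

lemma Escapes.of_preimage_linearMap {Z : Set (ℝ × ℝ)} (L : ℝ × ℝ →ₗ[ℝ] ℝ × ℝ)
    (hL : Function.Injective L) (h : Escapes (L ⁻¹' Z)) : Escapes Z := by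
  let e := (LinearEquiv.ofInjectiveEndo L hL).toContinuousLinearEquiv.toHomeomorph
  have he : ∀ x, e x = L x := fun x => rfl
  have := h.preimage e.symm
  convert this using 1
  ext x
  simp [← he]

lemma Escapes.preimage_linearMap {Z : Set (ℝ × ℝ)} (L : ℝ × ℝ →ₗ[ℝ] ℝ × ℝ)
    (hL : Function.Injective L) (h : Escapes Z) : Escapes (L ⁻¹' Z) :=
  h.preimage (LinearEquiv.ofInjectiveEndo L hL).toContinuousLinearEquiv.toHomeomorph

lemma exists_preconnected_of_strictMono {H : ℝ × ℝ → ℝ} (hH : Continuous H)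
    (hmono : ∀ t, StrictMono fun s => H (t, s)) {p : ℝ × ℝ} (hp : H p = 0) :
    ∃ S ⊆ {p | H p = 0}, IsPreconnected S ∧ p ∈ S ∧ ∃ q ∈ S, p.1 < q.1 := by
  obtain ⟨t₀, s₀⟩ := p
  have hneg : H (t₀, s₀ - 1) < 0 := by
    rw [← hp]; exact hmono t₀ (by linarith)
  have hpos : 0 < H (t₀, s₀ + 1) := by
    rw [← hp]; exact hmono t₀ (by linarith)
  have hslice : ∀ s, Continuous fun t => H (t, s) := fun s => by fun_prop
  have hev : ∀ᶠ t in 𝓝 t₀, H (t, s₀ - 1) < 0 ∧ 0 < H (t, s₀ + 1) :=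
    ((hslice _).continuousAt.eventually_lt continuousAt_const hneg).and
      (continuousAt_const.eventually_lt (hslice _).continuousAt hpos)
  obtain ⟨ε, hε, hball⟩ := Metric.eventually_nhds_iff_ball.1 hev
  have hroot : ∀ t ∈ Icc t₀ (t₀ + ε / 2), ∃ s, H (t, s) = 0 := by
    intro t ht
    have hb := hball t (by
      rw [Metric.mem_ball, Real.dist_eq, abs_of_nonneg (by linarith [ht.1])]
      linarith [ht.2])
    have hcont : Continuous fun s => H (t, s) := by fun_prop
    obtain ⟨s, -, hs⟩ := intermediate_value_Icc (by linarith : s₀ - 1 ≤ s₀ + 1)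
      hcont.continuousOn ⟨hb.1.le, hb.2.le⟩
    exact ⟨s, hs⟩
  choose! φ hφ using hroot
  have hφc : ContinuousOn φ (Icc t₀ (t₀ + ε / 2)) := by
    intro t ht
    refine tendsto_order.2 ⟨fun s hs => ?_, fun s hs => ?_⟩
    · have h1 : H (t, s) < 0 := by rw [← hφ t ht]; exact hmono t hs
      filter_upwards [((hslice s).continuousAt.eventually_lt continuousAt_const h1).filter_mono
        nhdsWithin_le_nhds, self_mem_nhdsWithin] with u hu hu'
      rw [← hφ u hu'] at hu
      exact (hmono u).lt_iff_lt.1 hu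
    · have h1 : 0 < H (t, s) := by rw [← hφ t ht]; exact hmono t hs
      filter_upwards [(continuousAt_const.eventually_lt (hslice s).continuousAt h1).filter_mono
        nhdsWithin_le_nhds, self_mem_nhdsWithin] with u hu hu'
      rw [← hφ u hu'] at hu
      exact (hmono u).lt_iff_lt.1 hu
  have hl : t₀ ∈ Icc t₀ (t₀ + ε / 2) := ⟨le_rfl, by linarith⟩
  have hr : t₀ + ε / 2 ∈ Icc t₀ (t₀ + ε / 2) := ⟨by linarith, le_rfl⟩
  refine ⟨(fun t => (t, φ t)) '' Icc t₀ (t₀ + ε / 2), ?_,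
    isPreconnected_Icc.image _ (continuousOn_id.prodMk hφc), ⟨t₀, hl, ?_⟩,
    _, ⟨_, hr, rfl⟩, by simpa using hε⟩
  · rintro _ ⟨t, ht, rfl⟩
    exact hφ t ht
  · exact Prod.ext rfl ((hmono t₀).injective ((hφ t₀ hl).trans hp.symm))

lemma escapes_of_strictMono {H : ℝ × ℝ → ℝ} (hH : Continuous H)
    (hmono : ∀ t, StrictMono fun s => H (t, s)) : Escapes {p | H p = 0} :=
  ⟨Prod.fst, continuous_fst, fun _ hp => exists_preconnected_of_strictMono hH hmono hp⟩

lemma escapes_of_unimodal {F G : ℝ → ℝ} (hF : Continuous F) (hG : Continuous G) (m : ℝ)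
    (hmono : StrictMonoOn F (Ici m)) (hanti : StrictAntiOn F (Iic m)) (hFG : ∀ t, F m ≤ G t) :
    Escapes {p : ℝ × ℝ | F p.2 = G p.1} := by
  refine ⟨Prod.fst, continuous_fst, fun p hp => ?_⟩
  have hp' : F p.2 = G p.1 := hp
  rcases le_total m p.2 with h | h
  · obtain ⟨S, hSZ, hS⟩ := exists_preconnected_of_strictMono (p := p)
      (H := fun p => F (max p.2 m) + min (p.2 - m) 0 - G p.1) (by fun_prop)
      (fun t s s' hs => by
        dsimp only
        rcases le_total m s with h | h
        · rw [max_eq_left h, max_eq_left (h.trans hs.le), min_eq_right (by linarith),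
            min_eq_right (by linarith)]
          linarith [hmono h (h.trans hs.le) hs]
        · have h1 : F m ≤ F (max s' m) :=
            hmono.monotoneOn self_mem_Ici (mem_Ici.2 (le_max_right _ _)) (le_max_right _ _)
          rw [max_eq_right h, min_eq_left (by linarith : s - m ≤ 0)]
          rcases eq_or_lt_of_le h with h' | h'
          · subst h'
            have : F s < F (max s' s) := hmono self_mem_Ici (hs.le.trans (le_max_left _ _)) (lt_max_of_lt_left hs)
            rw [min_eq_right (by linarith : 0 ≤ s' - s)]
            linarith
          · have : s - m < min (s' - m) 0 := lt_min (by linarith) (by linarith)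
            linarith)
      (by rw [max_eq_left h, min_eq_right (by linarith), hp']; ring)
    refine ⟨S, fun q hq => ?_, hS⟩
    have hq' : F (max q.2 m) + min (q.2 - m) 0 - G q.1 = 0 := hSZ hq
    have hm : m ≤ q.2 := by
      by_contra! hlt
      rw [max_eq_right hlt.le, min_eq_left (by linarith)] at hq'
      linarith [hFG q.1]
    rw [max_eq_left hm, min_eq_right (by linarith)] at hq'
    change F q.2 = G q.1
    linarith
  · obtain ⟨S, hSZ, hS⟩ := exists_preconnected_of_strictMono (p := p)
      (H := fun p => G p.1 + max (p.2 - m) 0 - F (min p.2 m)) (by fun_prop)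
      (fun t s s' hs => by
        dsimp only
        rcases le_total s' m with h | h
        · rw [min_eq_left h, min_eq_left (hs.le.trans h), max_eq_right (by linarith),
            max_eq_right (by linarith)]
          linarith [hanti (hs.le.trans h) h hs]
        · have h1 : F m ≤ F (min s m) :=
            hanti.antitoneOn (mem_Iic.2 (min_le_right _ _)) self_mem_Iic (min_le_right _ _)
          rw [min_eq_right h, max_eq_left (by linarith : 0 ≤ s' - m)]
          rcases eq_or_lt_of_le h with h' | h'
          · subst h'
            have : F m < F (min s m) := hanti ((min_le_left _ _).trans hs.le) self_mem_Iic (min_lt_of_left_lt hs)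
            rw [max_eq_right (by linarith : s - m ≤ 0)]
            linarith
          · have : max (s - m) 0 < s' - m := max_lt (by linarith) (by linarith)
            linarith)
      (by rw [min_eq_left h, max_eq_right (by linarith), hp']; ring)
    refine ⟨S, fun q hq => ?_, hS⟩
    have hq' : G q.1 + max (q.2 - m) 0 - F (min q.2 m) = 0 := hSZ hq
    have hm : q.2 ≤ m := by
      by_contra! hlt
      rw [min_eq_right hlt.le, max_eq_left (by linarith)] at hq'
      linarith [hFG q.1]
    rw [min_eq_left hm, max_eq_right (by linarith)] at hq'
    change F q.2 = G q.1
    linarith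

lemma isPreconnected_zero_set_of_convexOn {K : ℝ × ℝ → ℝ} (hK : Continuous K)
    (hconv : ConvexOn ℝ univ K) (hb : Bornology.IsBounded {x | K x ≤ 0}) :
    IsPreconnected {x | K x = 0} := by
  have hcv : Convex ℝ {x | K x ≤ 0} := by simpa using hconv.convex_le 0
  by_cases h : ∃ m, K m < 0
  · obtain ⟨m, hm⟩ := h
    have hclosed : IsClosed {x | K x ≤ 0} := isClosed_le hK continuous_const
    have hopen : IsOpen {x | K x < 0} := isOpen_lt hK continuous_const
    have hint : interior {x | K x ≤ 0} = {x | K x < 0} := by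
      refine subset_antisymm (fun x hx => ?_)
        (interior_maximal (fun x (hx : K x < 0) => hx.le) hopen)
      have hle : K x ≤ 0 := (interior_subset hx : x ∈ {x | K x ≤ 0})
      refine lt_of_le_of_ne hle fun h0 => ?_
      have hcont : ContinuousAt (fun t : ℝ => x + t • (x - m)) 0 := by fun_prop
      have hev : ∀ᶠ t : ℝ in 𝓝 0, K (x + t • (x - m)) ≤ 0 := by
        have := hcont.preimage_mem_nhds (t := {x | K x ≤ 0})
          (by simpa using mem_interior_iff_mem_nhds.1 hx)
        exact this
      obtain ⟨ε, hε, hball⟩ := Metric.eventually_nhds_iff_ball.1 hev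
      have h1 := hball (ε / 2) (by
        rw [Metric.mem_ball, Real.dist_eq, sub_zero, abs_of_pos (by linarith)]; linarith)
      have hpos : 0 < 1 + ε / 2 := by linarith
      have h2 := hconv.2 (mem_univ (x + (ε / 2) • (x - m))) (mem_univ m)
        (show 0 ≤ 1 / (1 + ε / 2) by positivity) (show 0 ≤ (ε / 2) / (1 + ε / 2) by positivity)
        (by field_simp)
      have h3 : (1 / (1 + ε / 2)) • (x + (ε / 2) • (x - m)) + ((ε / 2) / (1 + ε / 2)) • m = x := by
        ext <;> simp <;> field_simp <;> ring
      rw [h3, h0] at h2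
      have h4 : (1 / (1 + ε / 2)) • K (x + (ε / 2) • (x - m)) ≤ 0 :=
        smul_nonpos_of_nonneg_of_nonpos (by positivity) h1
      have h5 : ((ε / 2) / (1 + ε / 2)) • K m < 0 := smul_neg_of_pos_of_neg (by positivity) hm
      linarith
    obtain ⟨e, -, -, he⟩ := exists_homeomorph_image_interior_closure_frontier_eq_unitBall hcv
      (by rw [hint]; exact ⟨m, hm⟩) hb
    have hfr : frontier {x | K x ≤ 0} = {x | K x = 0} := by
      rw [hclosed.frontier_eq, hint]
      ext x
      simp [le_antisymm_iff]
    rw [← hfr, ← e.isPreconnected_image, he]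
    apply isPreconnected_sphere
    rw [rank_prod', Module.rank_self]
    norm_num
  · push Not at h
    have : {x | K x = 0} = {x | K x ≤ 0} := by
      ext x
      exact ⟨fun hx => le_of_eq hx, fun hx => le_antisymm hx (h x)⟩
    rw [this]
    exact hcv.isPreconnected

/-- The linear form on `ℝ × ℝ` with coefficient vector `a`. -/
noncomputable def pairing (a : ℝ × ℝ) : ℝ × ℝ →ₗ[ℝ] ℝ :=
  a.1 • LinearMap.fst ℝ ℝ ℝ + a.2 • LinearMap.snd ℝ ℝ ℝ

lemma pairing_apply (a u : ℝ × ℝ) : pairing a u = a.1 * u.1 + a.2 * u.2 := by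
  simp [pairing]

lemma pairing_sub (a b u : ℝ × ℝ) : pairing (a - b) u = pairing a u - pairing b u := by
  simp only [pairing_apply, Prod.fst_sub, Prod.snd_sub]; ring

lemma pairing_zero (u : ℝ × ℝ) : pairing 0 u = 0 := by
  simp [pairing_apply]

lemma pairing_self_pos {w : ℝ × ℝ} (hw : w ≠ 0) : 0 < pairing w w := by
  rw [pairing_apply]
  have h1 := mul_self_nonneg w.1
  have h2 := mul_self_nonneg w.2
  by_contra! hle
  exact hw (Prod.ext (mul_self_eq_zero.1 (by linarith)) (mul_self_eq_zero.1 (by linarith)))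

@[fun_prop]
lemma continuous_pairing (a : ℝ × ℝ) : Continuous (pairing a) :=
  (pairing a).continuous_of_finiteDimensional

/-- A 4-nomial in logarithmic coordinates. -/
noncomputable def expSum (c : Fin 4 → ℝ) (a : Fin 4 → ℝ × ℝ) (u : ℝ × ℝ) : ℝ :=
  ∑ i, c i * Real.exp (pairing (a i) u)

lemma continuous_expSum (c : Fin 4 → ℝ) (a : Fin 4 → ℝ × ℝ) : Continuous (expSum c a) := by
  unfold expSum; fun_prop

lemma expSum_neg (c : Fin 4 → ℝ) (a : Fin 4 → ℝ × ℝ) (u : ℝ × ℝ) :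
    expSum (-c) a u = -expSum c a u := by
  simp [expSum]

/-- A version of Stiemke's alternative: either a line properly separates the exponents with
positive coefficients from those with negative ones, or there is a strictly signed affine
dependence between the exponents. -/
lemma exists_separating_or_exists_dependence (c : Fin 4 → ℝ) (a : Fin 4 → ℝ × ℝ) :
    (∃ (v : ℝ × ℝ) (k : ℝ), (∀ i, 0 ≤ c i * (pairing (a i) v - k)) ∧
      ∃ i, 0 < c i * (pairing (a i) v - k)) ∨
    ∃ r : Fin 4 → ℝ, (∀ i, 0 < r i) ∧
      ∀ (w : ℝ × ℝ) (k : ℝ), ∑ i, r i * c i * (pairing (a i) w - k) = 0 := by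
  let T : (ℝ × ℝ) × ℝ →ₗ[ℝ] (Fin 4 → ℝ) := LinearMap.pi fun i =>
    c i • (pairing (a i) ∘ₗ LinearMap.fst ℝ (ℝ × ℝ) ℝ - LinearMap.snd ℝ (ℝ × ℝ) ℝ)
  have hT : ∀ y i, T y i = c i * (pairing (a i) y.1 - y.2) := fun y i => by simp [T]
  by_cases hd : Disjoint (LinearMap.range T : Set (Fin 4 → ℝ)) (stdSimplex ℝ (Fin 4))
  · right
    obtain ⟨φ, s, t, hs, hst, ht⟩ := geometric_hahn_banach_closed_compact
      (LinearMap.range T).convex (LinearMap.range T).closed_of_finiteDimensional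
      (convex_stdSimplex ℝ (Fin 4)) (isCompact_stdSimplex ℝ (Fin 4)) hd
    have hs0 : 0 < s := by simpa using hs 0 (zero_mem _)
    have hzero : ∀ y, φ (T y) = 0 := by
      intro y
      by_contra hne
      have := hs (T ((s / φ (T y)) • y)) ⟨_, rfl⟩
      rw [map_smul, map_smul, smul_eq_mul, div_mul_cancel₀ _ hne] at this
      exact lt_irrefl _ this
    refine ⟨fun i => φ (Pi.single i 1), fun i =>
      (hs0.trans hst).trans (ht _ (single_mem_stdSimplex ℝ i)), fun w k => ?_⟩
    have h := hzero (w, k)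
    rw [← ContinuousLinearMap.coe_coe, LinearMap.pi_apply_eq_sum_univ] at h
    rw [← h]
    refine Finset.sum_congr rfl fun i _ => ?_
    have hsingle : (fun j => if i = j then (1 : ℝ) else 0) = Pi.single i 1 := by
      ext j; simp [Pi.single_apply, eq_comm]
    rw [hT, hsingle, smul_eq_mul, ContinuousLinearMap.coe_coe]
    ring
  · left
    obtain ⟨_, ⟨y, rfl⟩, hy0, hy1⟩ := Set.not_disjoint_iff.1 hd
    refine ⟨y.1, y.2, fun i => hT y i ▸ hy0 i, ?_⟩
    by_contra! hle
    have : ∑ i, T y i ≤ 0 := Finset.sum_nonpos fun i _ => hT y i ▸ hle i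
    linarith

lemma escapes_of_separating {c : Fin 4 → ℝ} {a : Fin 4 → ℝ × ℝ} {v : ℝ × ℝ} {k : ℝ}
    (h0 : ∀ i, 0 ≤ c i * (pairing (a i) v - k)) (h1 : ∃ i, 0 < c i * (pairing (a i) v - k)) :
    Escapes {u | expSum c a u = 0} := by
  have key : ∀ u, StrictMono fun s : ℝ => Real.exp (-(k * s)) * expSum c a (s • v + u) := by
    intro u s s' hs
    have hform : ∀ s : ℝ, Real.exp (-(k * s)) * expSum c a (s • v + u) =
        ∑ i, c i * (Real.exp (pairing (a i) u) * Real.exp ((pairing (a i) v - k) * s)) := by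
      intro s
      rw [expSum, Finset.mul_sum]
      refine Finset.sum_congr rfl fun i _ => ?_
      rw [mul_left_comm, ← Real.exp_add, ← Real.exp_add, map_add, map_smul, smul_eq_mul]
      ring_nf
    have hterm : ∀ i, c i * (pairing (a i) v - k) ≤ 0 ∨
        c i * (Real.exp (pairing (a i) u) * Real.exp ((pairing (a i) v - k) * s)) <
        c i * (Real.exp (pairing (a i) u) * Real.exp ((pairing (a i) v - k) * s')) := by
      intro i
      refine (le_or_gt _ 0).imp_right fun hi => ?_
      rcases pos_and_pos_or_neg_and_neg_of_mul_pos hi with ⟨hc, hd⟩ | ⟨hc, hd⟩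
      · gcongr
      · refine mul_lt_mul_of_neg_left ?_ hc
        have := mul_lt_mul_of_neg_left hs hd
        gcongr
    dsimp only
    rw [hform, hform]
    refine Finset.sum_lt_sum (fun i _ => ?_) ?_
    · rcases hterm i with hi | hi
      · rcases mul_eq_zero.1 (le_antisymm hi (h0 i)) with hz | hz <;> simp [hz]
      · exact hi.le
    · obtain ⟨i, hi⟩ := h1
      exact ⟨i, Finset.mem_univ i, (hterm i).resolve_left hi.not_ge⟩
  by_cases hv : v = 0
  · refine ⟨fun _ => 0, continuous_const, fun p hp => ?_⟩
    have hp' : expSum c a p = 0 := hp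
    have := key p zero_lt_one
    simp [hv, hp'] at this
  · let L : ℝ × ℝ →ₗ[ℝ] ℝ × ℝ := (LinearMap.snd ℝ ℝ ℝ).smulRight v +
      (LinearMap.fst ℝ ℝ ℝ).smulRight (-v.2, v.1)
    have hL : ∀ p, L p = p.2 • v + p.1 • (-v.2, v.1) := fun p => by simp [L]
    have hpos : 0 < v.1 ^ 2 + v.2 ^ 2 := by
      simpa only [pairing_apply, ← sq] using pairing_self_pos hv
    have hinj : Function.Injective L := by
      rw [injective_iff_map_eq_zero]
      intro p hp
      rw [hL] at hp
      have e1 : p.2 * v.1 + p.1 * -v.2 = 0 := congrArg Prod.fst hp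
      have e2 : p.2 * v.2 + p.1 * v.1 = 0 := congrArg Prod.snd hp
      refine Prod.ext ?_ ?_
      · refine (mul_eq_zero.1 (?_ : p.1 * (v.1 ^ 2 + v.2 ^ 2) = 0)).resolve_right hpos.ne'
        linear_combination v.1 * e2 - v.2 * e1
      · refine (mul_eq_zero.1 (?_ : p.2 * (v.1 ^ 2 + v.2 ^ 2) = 0)).resolve_right hpos.ne'
        linear_combination v.1 * e1 + v.2 * e2
    refine Escapes.of_preimage_linearMap L hinj ?_
    have hc := (continuous_expSum c a).comp L.continuous_of_finiteDimensional
    have := escapes_of_strictMono (H := fun p => Real.exp (-(k * p.2)) * expSum c a (L p))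
      (by fun_prop) (fun t => by simpa only [hL] using key _)
    simpa [Real.exp_ne_zero] using this

lemma escapes_of_collinear (c : Fin 4 → ℝ) {a : Fin 4 → ℝ × ℝ} {w : ℝ × ℝ} (hw : w ≠ 0)
    (h : ∀ i j, pairing (a i) w = pairing (a j) w) : Escapes {u | expSum c a u = 0} := by
  refine ⟨pairing w, continuous_pairing w, fun p hp => ?_⟩
  have hp' : expSum c a p = 0 := hp
  refine ⟨range fun t : ℝ => p + t • w, ?_, isPreconnected_range (by fun_prop),
    ⟨0, by simp⟩, _, ⟨1, rfl⟩, by simpa using pairing_self_pos hw⟩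
  rintro _ ⟨t, rfl⟩
  have : expSum c a (p + t • w) = Real.exp (t * pairing (a 0) w) * expSum c a p := by
    rw [expSum, expSum, Finset.mul_sum]
    refine Finset.sum_congr rfl fun i _ => ?_
    rw [map_add, map_smul, smul_eq_mul, h i 0, Real.exp_add]
    ring
  simp [this, hp']

lemma isPreconnected_of_one_neg {c : Fin 4 → ℝ} {a : Fin 4 → ℝ × ℝ} (j : Fin 4)
    (hj : c j < 0) (hpos : ∀ i, i ≠ j → 0 < c i) {r : Fin 4 → ℝ} (hr : ∀ i, 0 < r i)
    (hdep : ∀ (w : ℝ × ℝ) (k : ℝ), ∑ i, r i * c i * (pairing (a i) w - k) = 0)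
    (hspan : ∀ w, (∀ i j, pairing (a i) w = pairing (a j) w) → w = 0) :
    IsPreconnected {u | expSum c a u = 0} := by
  let K : ℝ × ℝ → ℝ := fun u => ∑ i, c i * Real.exp (pairing (a i - a j) u)
  have hKg : ∀ u, K u = Real.exp (-pairing (a j) u) * expSum c a u := by
    intro u
    simp only [K, expSum]
    rw [Finset.mul_sum]
    refine Finset.sum_congr rfl fun i _ => ?_
    rw [pairing_sub, mul_left_comm, ← Real.exp_add]
    ring_nf
  have hset : {u | expSum c a u = 0} = {u | K u = 0} := by
    ext u; simp [hKg, Real.exp_ne_zero]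
  have hKc : Continuous K := by fun_prop
  have hKconv : ConvexOn ℝ univ K := by
    refine ⟨convex_univ, fun x _ y _ s t hs ht hst => ?_⟩
    simp only [K, smul_eq_mul, Finset.mul_sum]
    rw [← Finset.sum_add_distrib]
    refine Finset.sum_le_sum fun i _ => ?_
    by_cases hij : i = j
    · subst hij
      simp only [sub_self, pairing_zero, Real.exp_zero, mul_one]
      rw [← add_mul, hst, one_mul]
    · have := (convexOn_exp.comp_linearMap (pairing (a i - a j))).2 (mem_univ x) (mem_univ y)
        hs ht hst
      simp only [Function.comp_apply, smul_eq_mul] at this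
      nlinarith [mul_le_mul_of_nonneg_left this (hpos i hij).le]
  rw [hset]
  refine isPreconnected_zero_set_of_convexOn hKc hKconv ?_
  let B : ℝ × ℝ →ₗ[ℝ] (Fin 4 → ℝ) := LinearMap.pi fun i => pairing (a i - a j)
  have hBker : LinearMap.ker B = ⊥ := by
    rw [LinearMap.ker_eq_bot']
    intro w hw
    have hz : ∀ i, pairing (a i) w = pairing (a j) w := fun i => by
      have : pairing (a i - a j) w = 0 := congrFun hw i
      rwa [pairing_sub, sub_eq_zero] at this
    exact hspan w fun i i' => (hz i).trans (hz i').symm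
  obtain ⟨C, -, hC⟩ := B.exists_antilipschitzWith hBker
  let M : ℝ := ∑ i, |Real.log (-c j / c i)|
  have hM : ∀ i, |Real.log (-c j / c i)| ≤ M := fun i =>
    Finset.single_le_sum (f := fun i => |Real.log (-c j / c i)|) (fun _ _ => abs_nonneg _)
      (Finset.mem_univ i)
  have hcne : ∀ i, c i ≠ 0 := fun i => by
    by_cases hij : i = j
    · exact hij ▸ hj.ne
    · exact (hpos i hij).ne'
  have hν : ∀ i, 0 < r i * |c i| := fun i => mul_pos (hr i) (abs_pos.2 (hcne i))
  let N : ℝ := M * ∑ i, r i * |c i|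
  refine (hC.isBounded_preimage
    (Metric.isBounded_Icc (fun i => M - N / (r i * |c i|)) fun _ => M)).subset fun u hu => ?_
  have hu' : K u ≤ 0 := hu
  have hup : ∀ i, pairing (a i - a j) u ≤ M := by
    intro i
    by_cases hij : i = j
    · subst hij
      simpa [pairing_zero] using (abs_nonneg _).trans (hM i)
    · have hpair : ∑ l ∈ {i, j}, c l * Real.exp (pairing (a l - a j) u) ≤ K u :=
        Finset.sum_le_sum_of_subset_of_nonneg (Finset.subset_univ _) fun l _ hl =>
          (mul_pos (hpos l fun h => hl (by simp [h])) (Real.exp_pos _)).le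
      rw [Finset.sum_pair hij, pairing_sub (a j), sub_self, Real.exp_zero, mul_one] at hpair
      refine le_trans ?_ ((le_abs_self _).trans (hM i))
      rw [Real.le_log_iff_exp_le (div_pos (neg_pos.2 hj) (hpos i hij)),
        le_div_iff₀ (hpos i hij)]
      linarith
  have hsum : ∑ i, r i * |c i| * pairing (a i - a j) u = 0 := by
    rw [← hdep u (pairing (a j) u)]
    refine Finset.sum_congr rfl fun i _ => ?_
    rw [pairing_sub]
    by_cases hij : i = j
    · simp [hij]
    · rw [abs_of_pos (hpos i hij)]
  refine ⟨fun i => ?_, hup⟩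
  have hle : r i * |c i| * (M - pairing (a i - a j) u) ≤ N := by
    have hN : ∑ i, r i * |c i| * (M - pairing (a i - a j) u) = N := by
      simp only [mul_sub, Finset.sum_sub_distrib, hsum, N]
      rw [← Finset.sum_mul]; ring
    rw [← hN]
    exact Finset.single_le_sum (f := fun i => r i * |c i| * (M - pairing (a i - a j) u))
      (fun l _ => mul_nonneg (hν l).le (sub_nonneg.2 (hup l))) (Finset.mem_univ i)
  rw [mul_comm, ← le_div_iff₀ (hν i)] at hle
  change M - N / (r i * |c i|) ≤ pairing (a i - a j) u
  linarith

lemma exists_strictMonoOn_strictAntiOn {A B α β : ℝ} (hA : 0 < A) (hB : 0 < B) (hα : 0 < α)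
    (hβ : 0 < β) : ∃ m : ℝ,
      StrictMonoOn (fun s => A * Real.exp (α * s) + B * Real.exp (-(β * s))) (Ici m) ∧
      StrictAntiOn (fun s => A * Real.exp (α * s) + B * Real.exp (-(β * s))) (Iic m) := by
  have hd : ∀ s, deriv (fun s => A * Real.exp (α * s) + B * Real.exp (-(β * s))) s =
      A * α * Real.exp (-(β * s)) * (Real.exp ((α + β) * s) - B * β / (A * α)) := by
    intro s
    have h1 : HasDerivAt (fun s => α * s) α s := by simpa using (hasDerivAt_id s).const_mul α
    have h2 : HasDerivAt (fun s => -(β * s)) (-β) s := by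
      simpa using (hasDerivAt_id s).const_mul β |>.fun_neg
    rw [((h1.exp.const_mul A).fun_add (h2.exp.const_mul B)).deriv]
    have : Real.exp (α * s) = Real.exp (-(β * s)) * Real.exp ((α + β) * s) := by
      rw [← Real.exp_add]; ring_nf
    rw [this]
    field_simp
    ring
  have hq : 0 < B * β / (A * α) := by positivity
  refine ⟨Real.log (B * β / (A * α)) / (α + β),
    strictMonoOn_of_deriv_pos (convex_Ici _) (by fun_prop) fun s hs => ?_,
    strictAntiOn_of_deriv_neg (convex_Iic _) (by fun_prop) fun s hs => ?_⟩
  · rw [interior_Ici, mem_Ioi, div_lt_iff₀ (by positivity), Real.log_lt_iff_lt_exp hq,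
      mul_comm s] at hs
    rw [hd]
    exact mul_pos (by positivity) (sub_pos.2 hs)
  · rw [interior_Iic, mem_Iio, lt_div_iff₀ (by positivity), Real.lt_log_iff_exp_lt hq,
      mul_comm s] at hs
    rw [hd]
    exact mul_neg_of_pos_of_neg (by positivity) (sub_neg.2 hs)

lemma escapes_of_crossing {c₁ c₂ c₃ c₄ : ℝ} {a₁ a₂ a₃ a₄ : ℝ × ℝ} {r₁ r₂ r₃ r₄ : ℝ}
    (hc₁ : 0 < c₁) (hc₂ : 0 < c₂) (hc₃ : 0 < c₃) (hc₄ : 0 < c₄)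
    (hr₁ : 0 < r₁) (hr₂ : 0 < r₂) (hr₃ : 0 < r₃) (hr₄ : 0 < r₄) (hr : r₁ + r₂ = r₃ + r₄)
    (hdep : ∀ w, r₁ * pairing a₁ w + r₂ * pairing a₂ w = r₃ * pairing a₃ w + r₄ * pairing a₄ w)
    (hspan : ∀ w, pairing a₁ w = pairing a₂ w → pairing a₃ w = pairing a₄ w →
      pairing a₁ w = pairing a₃ w → w = 0) :
    Escapes {u | c₁ * Real.exp (pairing a₁ u) + c₂ * Real.exp (pairing a₂ u) =
      c₃ * Real.exp (pairing a₃ u) + c₄ * Real.exp (pairing a₄ u)} := by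
  have hR : 0 < r₁ + r₂ := add_pos hr₁ hr₂
  have hR' : 0 < r₃ + r₄ := add_pos hr₃ hr₄
  obtain ⟨m, hm₁, hm₂⟩ := exists_strictMonoOn_strictAntiOn hc₁ hc₂
    (div_pos hr₂ hR) (div_pos hr₁ hR)
  obtain ⟨n, hn₁, hn₂⟩ := exists_strictMonoOn_strictAntiOn hc₃ hc₄
    (div_pos hr₄ hR') (div_pos hr₃ hR')
  set F : ℝ → ℝ := fun s => c₁ * Real.exp (r₂ / (r₁ + r₂) * s) +
    c₂ * Real.exp (-(r₁ / (r₁ + r₂) * s)) with hF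
  set G : ℝ → ℝ := fun s => c₃ * Real.exp (r₄ / (r₃ + r₄) * s) +
    c₄ * Real.exp (-(r₃ / (r₃ + r₄) * s)) with hG
  have hFc : Continuous F := by fun_prop
  have hGc : Continuous G := by fun_prop
  have hmin : ∀ {f : ℝ → ℝ} {x : ℝ}, StrictMonoOn f (Ici x) → StrictAntiOn f (Iic x) →
      ∀ t, f x ≤ f t := fun {f x} h h' t => by
    rcases le_total x t with hx | hx
    · exact h.monotoneOn self_mem_Ici hx hx
    · exact h'.antitoneOn hx self_mem_Iic hx
  have hone : ∀ w, pairing (a₁ - a₂) w = 0 → pairing (a₃ - a₄) w = 0 → w = 0 := by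
    intro w h h'
    rw [pairing_sub, sub_eq_zero] at h h'
    refine hspan w h h' (mul_left_cancel₀ hR.ne' ?_)
    have := hdep w
    rw [← h, ← h'] at this
    linear_combination this + pairing a₃ w * -hr
  have hset : ∀ u, (c₁ * Real.exp (pairing a₁ u) + c₂ * Real.exp (pairing a₂ u) =
      c₃ * Real.exp (pairing a₃ u) + c₄ * Real.exp (pairing a₄ u)) ↔
      F (pairing (a₁ - a₂) u) = G (pairing (a₃ - a₄) u) := by
    intro u
    set o := (r₁ * pairing a₁ u + r₂ * pairing a₂ u) / (r₁ + r₂) with ho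
    have ho' : o = (r₃ * pairing a₃ u + r₄ * pairing a₄ u) / (r₃ + r₄) := by
      rw [ho, hdep, hr]
    have e₁ : pairing a₁ u = o + r₂ / (r₁ + r₂) * pairing (a₁ - a₂) u := by
      rw [ho, pairing_sub]; field_simp; ring
    have e₂ : pairing a₂ u = o + -(r₁ / (r₁ + r₂) * pairing (a₁ - a₂) u) := by
      rw [ho, pairing_sub]; field_simp; ring
    have e₃ : pairing a₃ u = o + r₄ / (r₃ + r₄) * pairing (a₃ - a₄) u := by
      rw [ho', pairing_sub]; field_simp; ring
    have e₄ : pairing a₄ u = o + -(r₃ / (r₃ + r₄) * pairing (a₃ - a₄) u) := by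
      rw [ho', pairing_sub]; field_simp; ring
    rw [e₁, e₂, e₃, e₄]
    simp only [Real.exp_add, hF, hG]
    refine ⟨fun h => mul_left_cancel₀ (Real.exp_ne_zero o) ?_, fun h => ?_⟩
    · linear_combination h
    · linear_combination Real.exp o * h
  rcases le_total (F m) (G n) with h | h
  · let L : ℝ × ℝ →ₗ[ℝ] ℝ × ℝ := (pairing (a₃ - a₄)).prod (pairing (a₁ - a₂))
    have := (escapes_of_unimodal hFc hGc m hm₁ hm₂
      fun t => h.trans (hmin hn₁ hn₂ t)).preimage_linearMap L
      ((injective_iff_map_eq_zero L).2 fun w hw =>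
        hone w (congrArg Prod.snd hw) (congrArg Prod.fst hw))
    convert this using 1
    ext u
    exact hset u
  · let L : ℝ × ℝ →ₗ[ℝ] ℝ × ℝ := (pairing (a₁ - a₂)).prod (pairing (a₃ - a₄))
    have := (escapes_of_unimodal hGc hFc n hn₁ hn₂
      fun t => h.trans (hmin hm₁ hm₂ t)).preimage_linearMap L
      ((injective_iff_map_eq_zero L).2 fun w hw =>
        hone w (congrArg Prod.fst hw) (congrArg Prod.snd hw))
    convert this using 1
    ext u
    exact (hset u).trans eq_comm

lemma isPreconnected_or_escapes {c : Fin 4 → ℝ} (hc : ∀ i, c i ≠ 0) (a : Fin 4 → ℝ × ℝ) :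
    IsPreconnected {u | expSum c a u = 0} ∨ Escapes {u | expSum c a u = 0} := by
  wlog h0 : 0 < c 0 generalizing c
  · have := this (c := -c) (fun i => neg_ne_zero.2 (hc i))
      (neg_pos.2 (lt_of_le_of_ne (not_lt.1 h0) (hc 0)))
    simpa only [expSum_neg, neg_eq_zero] using this
  by_cases hspan : ∀ w, (∀ i j, pairing (a i) w = pairing (a j) w) → w = 0
  swap
  · push Not at hspan
    obtain ⟨w, hw, hw0⟩ := hspan
    exact Or.inr (escapes_of_collinear c hw0 hw)
  rcases exists_separating_or_exists_dependence c a with ⟨v, k, hv, hv'⟩ | ⟨r, hr, hdep⟩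
  · exact Or.inr (escapes_of_separating hv hv')
  have hone : ∑ i, r i * c i = 0 := by
    have := hdep 0 (-1)
    simpa using this
  have hlin : ∀ w, ∑ i, r i * c i * pairing (a i) w = 0 := fun w => by
    simpa using hdep w 0
  have hspan' : ∀ w, (∀ i, pairing (a i) w = pairing (a 0) w) → w = 0 := fun w hw =>
    hspan w fun i j => (hw i).trans (hw j).symm
  have cross : ∀ {x y z : Fin 4}, (∀ g : Fin 4 → ℝ, ∑ i, g i = g 0 + g x + g y + g z) →
      (∀ i, i = 0 ∨ i = x ∨ i = y ∨ i = z) → 0 < c x → c y < 0 → c z < 0 →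
      Escapes {u | expSum c a u = 0} := by
    intro x y z hsum hcover hx hy hz
    rw [hsum] at hone
    simp only [hsum] at hlin
    have := escapes_of_crossing (a₁ := a 0) (a₂ := a x) (a₃ := a y) (a₄ := a z)
      h0 hx (neg_pos.2 hy) (neg_pos.2 hz) (mul_pos (hr 0) h0) (mul_pos (hr x) hx)
      (mul_pos (hr y) (neg_pos.2 hy)) (mul_pos (hr z) (neg_pos.2 hz)) (by linarith)
      (fun w => by linarith [hlin w]) (fun w h h' h'' => hspan' w fun i => by
        rcases hcover i with rfl | rfl | rfl | rfl
        exacts [rfl, h.symm, h''.symm, h'.symm.trans h''.symm])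
    convert this using 3
    rw [expSum, hsum]
    constructor <;> intro h <;> linear_combination h
  rcases (hc 1).lt_or_gt with h1 | h1 <;> rcases (hc 2).lt_or_gt with h2 | h2 <;>
    rcases (hc 3).lt_or_gt with h3 | h3
  · left
    have := isPreconnected_of_one_neg (c := -c) (a := a) 0 (neg_neg_of_pos h0)
      (by simp [Fin.forall_fin_succ, h1, h2, h3]) hr
      (fun w k => by simpa using hdep w k) hspan
    simpa only [expSum_neg, neg_eq_zero] using this
  · exact Or.inr (cross (x := 3) (y := 1) (z := 2)
      (fun g => by rw [Fin.sum_univ_four]; ring) (by decide) h3 h1 h2)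
  · exact Or.inr (cross (x := 2) (y := 1) (z := 3)
      (fun g => by rw [Fin.sum_univ_four]; ring) (by decide) h2 h1 h3)
  · exact Or.inl (isPreconnected_of_one_neg 1 h1
      (by simp [Fin.forall_fin_succ, h0, h2, h3]) hr hdep hspan)
  · exact Or.inr (cross (x := 1) (y := 2) (z := 3) Fin.sum_univ_four (by decide) h1 h2 h3)
  · exact Or.inl (isPreconnected_of_one_neg 2 h2
      (by simp [Fin.forall_fin_succ, h0, h1, h3]) hr hdep hspan)
  · exact Or.inl (isPreconnected_of_one_neg 3 h3
      (by simp [Fin.forall_fin_succ, h0, h1, h2]) hr hdep hspan)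
  · rw [Fin.sum_univ_four] at hone
    linarith [mul_pos (hr 0) h0, mul_pos (hr 1) h1, mul_pos (hr 2) h2, mul_pos (hr 3) h3]

/-- If the zero set `Z` in the positive quadrant of a bivariate 4-nomial has a
compact connected component `Γ`, then `Z = Γ`; in particular `Z` is
connected. -/
theorem four_nomial_compact_component_is_whole_zero_set
    (c : Fin 4 → ℝ) (a : Fin 4 → ℝ × ℝ)
    (hc : ∀ i, c i ≠ 0) (ha : Function.Injective a)
    (f : ℝ × ℝ → ℝ)
    (hf : ∀ x : ℝ × ℝ, f x = ∑ i, c i * (x.1 ^ (a i).1 * x.2 ^ (a i).2))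
    (Z : Set (ℝ × ℝ)) (hZ : Z = {x : ℝ × ℝ | 0 < x.1 ∧ 0 < x.2 ∧ f x = 0})
    (Γ : Set (ℝ × ℝ)) (z : ℝ × ℝ) (hz : z ∈ Z)
    (hΓ : Γ = connectedComponentIn Z z) (hΓc : IsCompact Γ) :
    Z = Γ := by
  let E : ℝ × ℝ → ℝ × ℝ := fun u => (Real.exp u.1, Real.exp u.2)
  let l : ℝ × ℝ → ℝ × ℝ := fun x => (Real.log x.1, Real.log x.2)
  have hE : Continuous E := by fun_prop
  have hlE : ∀ u, l (E u) = u := fun u => by simp [l, E]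
  have hfE : ∀ u, f (E u) = expSum c a u := by
    intro u
    rw [hf, expSum]
    refine Finset.sum_congr rfl fun i _ => ?_
    rw [← Real.exp_mul, ← Real.exp_mul, ← Real.exp_add, pairing_apply]
    ring_nf
  have hZE : Z = E '' {u | expSum c a u = 0} := by
    rw [hZ]
    ext x
    constructor
    · rintro ⟨h1, h2, h3⟩
      have hx : E (l x) = x := by simp [l, E, Real.exp_log h1, Real.exp_log h2]
      exact ⟨l x, by rw [mem_ofPred_eq, ← hfE, hx, h3], hx⟩
    · rintro ⟨u, hu, rfl⟩
      exact ⟨Real.exp_pos _, Real.exp_pos _, (hfE u).trans hu⟩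
  have hlc : ContinuousOn l Z := by
    rw [hZ]
    intro x hx
    have h1 : ContinuousAt (fun x : ℝ × ℝ => Real.log x.1) x :=
      continuousAt_fst.log hx.1.ne'
    have h2 : ContinuousAt (fun x : ℝ × ℝ => Real.log x.2) x :=
      continuousAt_snd.log hx.2.1.ne'
    exact (h1.prodMk h2).continuousWithinAt
  rcases isPreconnected_or_escapes hc a with h | ⟨m, hm, h⟩
  · rw [hΓ]
    refine (IsPreconnected.connectedComponentIn ?_ hz).symm
    rw [hZE]
    exact h.image _ hE.continuousOn
  · exfalso
    have hΓZ : Γ ⊆ Z := hΓ ▸ connectedComponentIn_subset Z z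
    obtain ⟨p, hp, hmax⟩ := hΓc.exists_isMaxOn ⟨z, hΓ ▸ mem_connectedComponentIn hz⟩
      (hm.comp_continuousOn (hlc.mono hΓZ))
    obtain ⟨u, hu, rfl⟩ : p ∈ E '' {u | expSum c a u = 0} := hZE ▸ hΓZ hp
    obtain ⟨S, hSZ, hS, huS, q, hqS, hq⟩ := h u hu
    have hsub : E '' S ⊆ Γ := by
      rw [hΓ, connectedComponentIn_eq (hΓ ▸ hp : E u ∈ connectedComponentIn Z z)]
      exact (hS.image _ hE.continuousOn).subset_connectedComponentIn ⟨u, huS, rfl⟩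
        (hZE ▸ image_mono hSZ)
    have hle : m (l (E q)) ≤ m (l (E u)) := hmax (hsub ⟨q, hqS, rfl⟩)
    rw [hlE, hlE] at hle
    exact hle.not_gt hq
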